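/- Fix γ ∈ ℝ with 0 < γ ≤ 1. Let x0 ∈ ℝⁿ be a k-sparse vector, let a_1, …, a_m be independent standard Gaussian random vectors in ℝⁿ, and suppose the magnitudes |⟨a_i, x0⟩| for i = 1…m are observed. Let φ be a unit vector with ⟨φ, x0/‖x0‖₂⟩ =: α > γ, and assume k < (1/49)·α²·n. Let λ satisfy (1/2)·α/√k < λ < (3/4)·α/√k. Then there exist positive universal constants C₁, C₂, c (depending only on γ for C₁) such that if m ≥ C₁·k·log(n/k) then x0 is the unique maximizer of SparsePhaseMax with probability at least 1 − C₂·exp(−c·k). -/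

import Mathlib

open MeasureTheory ProbabilityTheory

/-- The ℓ² (Euclidean) norm on ℝⁿ. -/
noncomputable def l2norm {n : ℕ} (x : Fin n → ℝ) : ℝ := Real.sqrt (∑ j, (x j) ^ 2)

/-- The ℓ¹ norm on ℝⁿ. -/
noncomputable def l1norm {n : ℕ} (x : Fin n → ℝ) : ℝ := ∑ j, |x j|

/-- The Euclidean inner product on ℝⁿ. -/
noncomputable def dot {n : ℕ} (x y : Fin n → ℝ) : ℝ := ∑ j, x j * y j

/-- The joint law of `m` independent standard Gaussian random vectors in ℝⁿ:
each of the `m * n` coordinates is an independent standard normal. -/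
noncomputable def stdGaussianVectors (m n : ℕ) : Measure (Fin m → Fin n → ℝ) :=
  Measure.pi fun _ : Fin m => Measure.pi fun _ : Fin n => gaussianReal 0 1

/-- `x` is feasible for SparsePhaseMax with measurements `a` and data `|⟨a i, x0⟩|`. -/
def SPMFeasible {n m : ℕ} (a : Fin m → Fin n → ℝ) (x0 x : Fin n → ℝ) : Prop :=
  ∀ i, -|dot (a i) x0| ≤ dot (a i) x ∧ dot (a i) x ≤ |dot (a i) x0|

/-- `x0` is the unique maximizer of SparsePhaseMax with anchor `φ` and parameter `λ`. -/
def SPMUniqueMax {n m : ℕ} (a : Fin m → Fin n → ℝ) (x0 φ : Fin n → ℝ) (lam : ℝ) : Prop :=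
  ∀ x : Fin n → ℝ, SPMFeasible a x0 x → x ≠ x0 →
    dot φ x - lam * l1norm x < dot φ x0 - lam * l1norm x0

/-- The law of a single standard Gaussian vector in ℝⁿ. -/
noncomputable abbrev stdGaussianVector (n : ℕ) : Measure (Fin n → ℝ) :=
  Measure.pi fun _ : Fin n => gaussianReal 0 1

lemma map_apply_stdGaussianVector {n : ℕ} (j : Fin n) :
    (stdGaussianVector n).map (fun a => a j) = gaussianReal 0 1 :=
  (measurePreserving_eval (fun _ : Fin n => gaussianReal 0 1) j).map_eq

lemma hasGaussianLaw_stdGaussianVector (n : ℕ) :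
    HasGaussianLaw (fun (a : Fin n → ℝ) j => a j) (stdGaussianVector n) := by
  refine iIndepFun.hasGaussianLaw (X := fun j (a : Fin n → ℝ) => a j) (fun j => ?_) ?_
  · have : IsGaussian ((stdGaussianVector n).map (fun a => a j)) := by
      rw [map_apply_stdGaussianVector]
      infer_instance
    exact IsGaussian.hasGaussianLaw
  · exact iIndepFun_pi (X := fun _ x => x) (fun _ => aemeasurable_id)

/-- `x ↦ ⟨x, z⟩` as a continuous linear map. -/
noncomputable def dotCLM {n : ℕ} (z : Fin n → ℝ) : (Fin n → ℝ) →L[ℝ] ℝ :=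
  ∑ j, (z j) • ContinuousLinearMap.proj (R := ℝ) (φ := fun _ : Fin n => ℝ) j

lemma dotCLM_apply {n : ℕ} (z a : Fin n → ℝ) : dotCLM z a = dot a z := by
  simp [dotCLM, dot, mul_comm]

lemma measurable_dot {n : ℕ} (z : Fin n → ℝ) : Measurable (fun a : Fin n → ℝ => dot a z) := by
  unfold dot; fun_prop

lemma hasGaussianLaw_dot_prodMk {n : ℕ} (u z : Fin n → ℝ) :
    HasGaussianLaw (fun a => (dot a u, dot a z)) (stdGaussianVector n) := by
  simpa [dotCLM_apply] using
    (hasGaussianLaw_stdGaussianVector n).map_fun ((dotCLM u).prod (dotCLM z))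

lemma hasGaussianLaw_dot {n : ℕ} (z : Fin n → ℝ) :
    HasGaussianLaw (fun a => dot a z) (stdGaussianVector n) :=
  (hasGaussianLaw_dot_prodMk z z).fst

lemma integral_dot {n : ℕ} (z : Fin n → ℝ) : ∫ a, dot a z ∂stdGaussianVector n = 0 := by
  unfold dot
  rw [integral_finsetSum]
  · refine Finset.sum_eq_zero fun j _ => ?_
    rw [integral_mul_const, ← integral_map (φ := fun a : Fin n → ℝ => a j) (f := fun x => x)
      (measurable_pi_apply j).aemeasurable (by fun_prop), map_apply_stdGaussianVector]
    simp
  · exact fun j _ => (((hasGaussianLaw_stdGaussianVector n).eval j).integrable).mul_const _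

lemma covariance_dot {n : ℕ} (u z : Fin n → ℝ) :
    cov[fun a => dot a u, fun a => dot a z; stdGaussianVector n] = dot u z := by
  have hL : ∀ j, MemLp (fun a : Fin n → ℝ => a j) 2 (stdGaussianVector n) :=
    fun j => ((hasGaussianLaw_stdGaussianVector n).eval j).memLp_two
  have hind : iIndepFun (fun j (a : Fin n → ℝ) => a j) (stdGaussianVector n) :=
    iIndepFun_pi (X := fun _ x => x) (fun _ => aemeasurable_id)
  have hcov : ∀ i j, cov[fun a : Fin n → ℝ => a i, fun a => a j; stdGaussianVector n]
      = if i = j then 1 else 0 := by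
    intro i j
    split_ifs with h
    · subst h
      have hm : AEMeasurable (fun a : Fin n → ℝ => a i) (stdGaussianVector n) :=
        (measurable_pi_apply i).aemeasurable
      rw [covariance_self hm]
      change Var[(fun x : ℝ => x) ∘ (fun a : Fin n → ℝ => a i); stdGaussianVector n] = 1
      rw [← variance_map (by fun_prop) hm, map_apply_stdGaussianVector]
      simp
    · exact (hind.indepFun h).covariance_eq_zero (hL i) (hL j)
  unfold dot
  rw [covariance_fun_sum_fun_sum (fun i => (hL i).mul_const _) (fun i => (hL i).mul_const _)]
  simp_rw [covariance_mul_const_left, covariance_mul_const_right, hcov]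
  simp [mul_comm]

lemma indepFun_dot {n : ℕ} {u z : Fin n → ℝ} (h : dot u z = 0) :
    IndepFun (fun a => dot a u) (fun a => dot a z) (stdGaussianVector n) :=
  (hasGaussianLaw_dot_prodMk u z).indepFun_of_covariance_eq_zero (by rw [covariance_dot, h])

lemma l2norm_nonneg {n : ℕ} (z : Fin n → ℝ) : 0 ≤ l2norm z := Real.sqrt_nonneg _

lemma dot_self {n : ℕ} (z : Fin n → ℝ) : dot z z = l2norm z ^ 2 := by
  rw [l2norm, Real.sq_sqrt (Finset.sum_nonneg fun _ _ => sq_nonneg _)]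
  simp [dot, sq]

lemma integral_dot_sq {n : ℕ} (z : Fin n → ℝ) :
    ∫ a, dot a z ^ 2 ∂stdGaussianVector n = l2norm z ^ 2 := by
  rw [← dot_self, ← covariance_dot, covariance_self (measurable_dot z).aemeasurable,
    variance_eq_integral (measurable_dot z).aemeasurable, integral_dot]
  simp

lemma map_dot {n : ℕ} (z : Fin n → ℝ) :
    (stdGaussianVector n).map (fun a => dot a z) =
      (gaussianReal 0 1).map (fun x => l2norm z * x) := by
  rw [(hasGaussianLaw_dot z).map_eq_gaussianReal, gaussianReal_map_const_mul, integral_dot,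
    ← covariance_self (measurable_dot z).aemeasurable, covariance_dot, dot_self]
  congr 1
  · simp
  · ext; simp [sq_nonneg]

/-- The first absolute moment of a standard normal variable. -/
noncomputable def gaussianAbsMoment : ℝ := ∫ x, |x| ∂gaussianReal 0 1

lemma gaussianAbsMoment_pos : 0 < gaussianAbsMoment := by
  have hint : Integrable (fun x : ℝ => |x|) (gaussianReal 0 1) :=
    ((memLp_id_gaussianReal 1).integrable (by simp)).abs
  rw [gaussianAbsMoment, integral_pos_iff_support_of_nonneg (fun _ => abs_nonneg _) hint]
  have : Function.support (fun x : ℝ => |x|) = {0}ᶜ := by ext; simp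
  have := nullSingletonClass_gaussianReal (μ := 0) (v := 1) one_ne_zero
  rw [‹Function.support _ = _›, prob_compl_eq_one_sub (measurableSet_singleton _)]
  simp

lemma integral_abs_dot {n : ℕ} (z : Fin n → ℝ) :
    ∫ a, |dot a z| ∂stdGaussianVector n = gaussianAbsMoment * l2norm z := by
  rw [← integral_map (φ := fun a : Fin n → ℝ => dot a z) (f := fun x => |x|)
    (measurable_dot z).aemeasurable (by fun_prop), map_dot, integral_map (by fun_prop) (by fun_prop)]
  simp_rw [abs_mul, abs_of_nonneg (l2norm_nonneg z), integral_const_mul]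
  rw [mul_comm, gaussianAbsMoment]

/-- The sign of a real number, with the convention that the sign of `0` is `1`. -/
noncomputable def sgn (x : ℝ) : ℝ := if 0 ≤ x then 1 else -1

lemma measurable_sgn : Measurable sgn :=
  Measurable.ite measurableSet_Ici measurable_const measurable_const

lemma sgn_mul_self (x : ℝ) : sgn x * x = |x| := by
  unfold sgn
  split_ifs with h
  · rw [abs_of_nonneg h, one_mul]
  · rw [abs_of_neg (not_le.1 h), neg_one_mul]

lemma abs_sgn (x : ℝ) : |sgn x| = 1 := by
  unfold sgn; split_ifs <;> simp

lemma dot_add_smul {n : ℕ} (a x y : Fin n → ℝ) (r s : ℝ) :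
    dot a (r • x + s • y) = r * dot a x + s * dot a y := by
  simp only [dot, Pi.add_apply, Pi.smul_apply, smul_eq_mul, Finset.mul_sum,
    ← Finset.sum_add_distrib]
  exact Finset.sum_congr rfl fun _ _ => by ring

lemma integrable_dot {n : ℕ} (z : Fin n → ℝ) :
    Integrable (fun a => dot a z) (stdGaussianVector n) := (hasGaussianLaw_dot z).integrable

lemma integrable_sgn_mul_dot {n : ℕ} (u z : Fin n → ℝ) :
    Integrable (fun a => sgn (dot a u) * dot a z) (stdGaussianVector n) :=
  (integrable_dot z).bdd_mul (c := 1)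
    (measurable_sgn.comp (measurable_dot u)).aestronglyMeasurable
    (Filter.Eventually.of_forall fun a => by simp [abs_sgn])

lemma integral_sgn_mul_dot {n : ℕ} {u : Fin n → ℝ} (hu : l2norm u = 1) (z : Fin n → ℝ) :
    ∫ a, sgn (dot a u) * dot a z ∂stdGaussianVector n = gaussianAbsMoment * dot u z := by
  set w : Fin n → ℝ := (1 : ℝ) • z + (-dot u z) • u with hw
  have huw : dot u w = 0 := by rw [hw, dot_add_smul, dot_self, hu]; ring
  have hdec : ∀ a, sgn (dot a u) * dot a z =
      dot u z * |dot a u| + sgn (dot a u) * dot a w := by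
    intro a
    rw [hw, dot_add_smul, ← sgn_mul_self]; ring
  have hindep := (indepFun_dot huw).comp measurable_sgn measurable_id
  have h0 : ∫ a, sgn (dot a u) * dot a w ∂stdGaussianVector n = 0 := by
    have := hindep.integral_fun_mul_eq_mul_integral
      (measurable_sgn.comp (measurable_dot u)).aestronglyMeasurable
      (measurable_dot w).aestronglyMeasurable
    simp only [Function.comp_apply, id, integral_dot, mul_zero] at this
    simpa using this
  simp_rw [hdec]
  rw [integral_add ((integrable_dot u).abs.const_mul _) (integrable_sgn_mul_dot u w), h0,
    integral_const_mul, integral_abs_dot, hu]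
  ring

/-- Chernoff's bound for a sum of i.i.d. random variables. -/
lemma measure_pi_sum_nonneg_le {E : Type*} [MeasurableSpace E] (ν : Measure E)
    [IsProbabilityMeasure ν] {Y : E → ℝ} {c : ℝ} (m : ℕ)
    (hint : Integrable (fun x => Real.exp (Y x)) ν)
    (hY : ∫ x, Real.exp (Y x) ∂ν ≤ Real.exp (-c)) :
    (Measure.pi fun _ : Fin m => ν) {a | 0 ≤ ∑ i, Y (a i)} ≤
      ENNReal.ofReal (Real.exp (-c * m)) := by
  have hexp : ∀ a : Fin m → E, Real.exp (∑ i, Y (a i)) = ∏ i, Real.exp (Y (a i)) :=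
    fun a => Real.exp_sum _ _
  have hmarkov := mul_meas_ge_le_integral_of_nonneg
    (μ := Measure.pi fun _ : Fin m => ν) (f := fun a => ∏ i, Real.exp (Y (a i)))
    (Filter.Eventually.of_forall fun a => Finset.prod_nonneg fun i _ => (Real.exp_pos _).le)
    (Integrable.fintype_prod fun _ => hint) 1
  rw [one_mul, integral_fintype_prod_eq_pow (fun x => Real.exp (Y x)), Fintype.card_fin] at hmarkov
  have hset : {a : Fin m → E | 0 ≤ ∑ i, Y (a i)} = {a | 1 ≤ ∏ i, Real.exp (Y (a i))} := by
    ext a; simp [← hexp, Real.one_le_exp_iff]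
  rw [hset, ← ENNReal.ofReal_toReal (measure_ne_top (Measure.pi fun _ : Fin m => ν) _)]
  refine ENNReal.ofReal_le_ofReal (hmarkov.trans ?_)
  calc (∫ x, Real.exp (Y x) ∂ν) ^ m ≤ Real.exp (-c) ^ m := by
        gcongr
    _ = Real.exp (-c * m) := by rw [← Real.exp_nat_mul]; ring_nf

/-- A uniform tail bound for the squared norms of the columns of a Gaussian matrix. -/
lemma exists_measure_sum_sq_le :
    ∃ B : ℝ, 0 < B ∧ ∀ (n m : ℕ) (j : Fin n),
      stdGaussianVectors m n {a | B * m ≤ ∑ i, a i j ^ 2} ≤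
        ENNReal.ofReal (Real.exp (-m)) := by
  obtain ⟨C, hC, hint⟩ := IsGaussian.exists_integrable_exp_sq (gaussianReal 0 1)
  simp only [Real.norm_eq_abs, sq_abs] at hint
  set K := ∫ x, Real.exp (C * x ^ 2) ∂gaussianReal 0 1 with hK
  have hK1 : 1 ≤ K := by
    have : ∫ _, (1 : ℝ) ∂gaussianReal 0 1 ≤ K :=
      integral_mono (integrable_const _) hint fun x => Real.one_le_exp (by positivity)
    simpa using this
  have hK0 : 0 < K := by linarith
  refine ⟨(1 + Real.log K) / C, div_pos (by linarith [Real.log_nonneg hK1]) hC, fun n m j => ?_⟩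
  have hlaw : ∀ x : ℝ, Real.exp (C * x ^ 2 - (1 + Real.log K)) =
      Real.exp (-1) / K * Real.exp (C * x ^ 2) := by
    intro x
    rw [sub_eq_add_neg, neg_add, Real.exp_add, Real.exp_add, Real.exp_neg (Real.log K),
      Real.exp_log hK0]
    ring
  have hmp := measurePreserving_eval (fun _ : Fin n => gaussianReal 0 1) j
  have hbound := measure_pi_sum_nonneg_le (stdGaussianVector n)
    (Y := fun a => C * a j ^ 2 - (1 + Real.log K)) (c := 1) m ?_ ?_
  · have hset : {a : Fin m → Fin n → ℝ | (1 + Real.log K) / C * m ≤ ∑ i, a i j ^ 2} =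
        {a | 0 ≤ ∑ i, (C * a i j ^ 2 - (1 + Real.log K))} := by
      ext a
      simp only [Set.mem_ofPred_eq, Finset.sum_sub_distrib, ← Finset.mul_sum, Finset.sum_const,
        Finset.card_univ, Fintype.card_fin, nsmul_eq_mul, sub_nonneg]
      rw [div_mul_eq_mul_div, div_le_iff₀ hC]
      constructor <;> intro h <;> linarith
    rw [hset]
    simpa [stdGaussianVectors] using hbound
  · simp_rw [hlaw]
    exact (hmp.integrable_comp_of_integrable hint).const_mul _
  · simp_rw [hlaw]
    rw [integral_const_mul, ← integral_map (φ := fun a : Fin n → ℝ => a j)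
      (f := fun x => Real.exp (C * x ^ 2)) (measurable_pi_apply j).aemeasurable (by fun_prop),
      map_apply_stdGaussianVector, ← hK, div_mul_cancel₀ _ hK0.ne']

/-- The positive part of `⟨a, z⟩` after aligning signs with `⟨a, u⟩`. -/
noncomputable def alignedPart {n : ℕ} (u z a : Fin n → ℝ) : ℝ :=
  (|dot a z| + sgn (dot a u) * dot a z) / 2

lemma abs_sgn_mul (x y : ℝ) : |sgn x * y| = |y| := by rw [abs_mul, abs_sgn, one_mul]

lemma alignedPart_nonneg {n : ℕ} (u z a : Fin n → ℝ) : 0 ≤ alignedPart u z a := by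
  have := neg_abs_le (sgn (dot a u) * dot a z)
  rw [abs_sgn_mul] at this
  unfold alignedPart; linarith

lemma alignedPart_le_abs {n : ℕ} (u z a : Fin n → ℝ) : alignedPart u z a ≤ |dot a z| := by
  have := le_abs_self (sgn (dot a u) * dot a z)
  rw [abs_sgn_mul] at this
  unfold alignedPart; linarith

lemma exp_neg_le_quadratic {y : ℝ} (hy : 0 ≤ y) : Real.exp (-y) ≤ 1 - y + y ^ 2 / 2 := by
  have h := Real.quadratic_le_exp_of_nonneg hy
  have hpos : 0 < 1 - y + y ^ 2 / 2 := by nlinarith [sq_nonneg (y - 1)]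
  rw [Real.exp_neg, inv_le_comm₀ (Real.exp_pos _) hpos]
  refine le_trans ?_ h
  rw [inv_le_iff_one_le_mul₀ hpos]
  nlinarith [sq_nonneg (y ^ 2)]

lemma integrable_alignedPart {n : ℕ} (u z : Fin n → ℝ) :
    Integrable (alignedPart u z) (stdGaussianVector n) :=
  ((integrable_dot z).abs.add (integrable_sgn_mul_dot u z)).div_const 2

lemma integral_alignedPart {n : ℕ} {u : Fin n → ℝ} (hu : l2norm u = 1) (z : Fin n → ℝ) :
    ∫ a, alignedPart u z a ∂stdGaussianVector n =
      gaussianAbsMoment * (l2norm z + dot u z) / 2 := by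
  unfold alignedPart
  rw [integral_div, integral_add (integrable_dot z).abs (integrable_sgn_mul_dot u z),
    integral_abs_dot, integral_sgn_mul_dot hu, mul_add]

lemma integrable_exp_neg_alignedPart {n : ℕ} (u z : Fin n → ℝ) {t : ℝ} (ht : 0 ≤ t) :
    Integrable (fun a => Real.exp (-(t * alignedPart u z a))) (stdGaussianVector n) := by
  refine (integrable_const (1 : ℝ)).mono' ?_ (Filter.Eventually.of_forall fun a => ?_)
  · exact Real.continuous_exp.comp_aestronglyMeasurable
      ((integrable_alignedPart u z).aestronglyMeasurable.const_mul t).neg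
  · rw [Real.norm_eq_abs, Real.abs_exp, Real.exp_le_one_iff]
    have := mul_nonneg ht (alignedPart_nonneg u z a)
    linarith

lemma integral_exp_neg_alignedPart_le {n : ℕ} {u : Fin n → ℝ} (hu : l2norm u = 1)
    (z : Fin n → ℝ) {t : ℝ} (ht : 0 ≤ t) :
    ∫ a, Real.exp (-(t * alignedPart u z a)) ∂stdGaussianVector n ≤
      Real.exp (-(t * (gaussianAbsMoment * (l2norm z + dot u z) / 2)) +
        t ^ 2 * l2norm z ^ 2 / 2) := by
  have hsq : Integrable (fun a => dot a z ^ 2) (stdGaussianVector n) :=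
    (hasGaussianLaw_dot z).memLp_two.integrable_sq
  have hX := (integrable_alignedPart u z).const_mul t
  have h1 : Integrable (fun a => 1 - t * alignedPart u z a) (stdGaussianVector n) :=
    (integrable_const (1 : ℝ)).sub hX
  calc ∫ a, Real.exp (-(t * alignedPart u z a)) ∂stdGaussianVector n
      ≤ ∫ a, (1 - t * alignedPart u z a + t ^ 2 / 2 * dot a z ^ 2) ∂stdGaussianVector n := by
        refine integral_mono (integrable_exp_neg_alignedPart u z ht)
          (h1.add (hsq.const_mul _)) fun a => ?_
        have h0 := alignedPart_nonneg u z a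
        have hle : alignedPart u z a ^ 2 ≤ dot a z ^ 2 := by
          rw [← sq_abs (dot a z)]
          exact pow_le_pow_left₀ h0 (alignedPart_le_abs u z a) 2
        have := exp_neg_le_quadratic (mul_nonneg ht h0)
        have := mul_le_mul_of_nonneg_left hle (sq_nonneg t)
        dsimp only
        nlinarith
    _ = 1 - t * (gaussianAbsMoment * (l2norm z + dot u z) / 2) + t ^ 2 / 2 * l2norm z ^ 2 := by
        rw [integral_add h1 (hsq.const_mul _), integral_sub (integrable_const _) hX,
          integral_const_mul, integral_const_mul, integral_alignedPart hu, integral_dot_sq]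
        simp
    _ ≤ _ := by
        refine le_trans (le_of_eq ?_) (Real.add_one_le_exp _)
        ring

/-- Lower tail bound for the sum of the sign-aligned parts of `⟨aᵢ, z⟩`. -/
lemma measure_sum_alignedPart_le {n : ℕ} (m : ℕ) {u z : Fin n → ℝ} (hu : l2norm u = 1)
    (hz : l2norm z ≤ 2) {η ε : ℝ} (hη : 0 < η) (hzu : η ≤ l2norm z + dot u z)
    (hε : ε ≤ gaussianAbsMoment * η / 8) :
    stdGaussianVectors m n {a | ∑ i, alignedPart u z (a i) ≤ ε * m} ≤
      ENNReal.ofReal (Real.exp (-((gaussianAbsMoment * η) ^ 2 / 64) * m)) := by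
  set b := gaussianAbsMoment * η with hb
  have hb0 : 0 < b := mul_pos gaussianAbsMoment_pos hη
  have ht : 0 ≤ b / 16 := by positivity
  have hlaw : ∀ a, Real.exp (b / 16 * ε - b / 16 * alignedPart u z a) =
      Real.exp (b / 16 * ε) * Real.exp (-(b / 16 * alignedPart u z a)) := fun a => by
    rw [← Real.exp_add, sub_eq_add_neg]
  have hbound := measure_pi_sum_nonneg_le (stdGaussianVector n)
    (Y := fun a => b / 16 * ε - b / 16 * alignedPart u z a) (c := b ^ 2 / 64) m ?_ ?_
  · refine le_trans (measure_mono fun a ha => ?_) hbound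
    have hsum := mul_le_mul_of_nonneg_left ha ht
    rw [Finset.mul_sum] at hsum
    simp only [Set.mem_ofPred_eq, Finset.sum_sub_distrib, Finset.sum_const, Finset.card_univ,
      Fintype.card_fin, nsmul_eq_mul, sub_nonneg]
    linarith
  · simp_rw [hlaw]
    exact (integrable_exp_neg_alignedPart u z ht).const_mul _
  · simp_rw [hlaw]
    rw [integral_const_mul]
    refine (mul_le_mul_of_nonneg_left (integral_exp_neg_alignedPart_le hu z ht)
      (Real.exp_pos _).le).trans ?_
    rw [← Real.exp_add, Real.exp_le_exp]
    have h1 : b ≤ gaussianAbsMoment * (l2norm z + dot u z) :=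
      mul_le_mul_of_nonneg_left hzu gaussianAbsMoment_pos.le
    have h2 : l2norm z ^ 2 ≤ 4 := by nlinarith [l2norm_nonneg z]
    have h3 := mul_le_mul_of_nonneg_left hε ht
    have h4 := mul_le_mul_of_nonneg_left h1 ht
    have h5 := mul_le_mul_of_nonneg_left h2 (sq_nonneg (b / 16))
    nlinarith

lemma l2norm_eq_norm {n : ℕ} (x : Fin n → ℝ) : l2norm x = ‖WithLp.toLp 2 x‖ := by
  simp [l2norm, EuclideanSpace.norm_eq]

lemma l2norm_add_le {n : ℕ} (x y : Fin n → ℝ) : l2norm (x + y) ≤ l2norm x + l2norm y := by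
  simp only [l2norm_eq_norm, WithLp.toLp_add]
  exact norm_add_le _ _

lemma l2norm_smul {n : ℕ} (r : ℝ) (x : Fin n → ℝ) : l2norm (r • x) = |r| * l2norm x := by
  simp only [l2norm_eq_norm, WithLp.toLp_smul, norm_smul, Real.norm_eq_abs]

lemma abs_dot_le {n : ℕ} (x y : Fin n → ℝ) : |dot x y| ≤ l2norm x * l2norm y := by
  have h := abs_real_inner_le_norm (WithLp.toLp 2 y) (WithLp.toLp 2 x)
  rw [l2norm_eq_norm, l2norm_eq_norm, mul_comm ‖WithLp.toLp 2 x‖]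
  simpa [dot, PiLp.inner_apply] using h

lemma dot_add {n : ℕ} (a x y : Fin n → ℝ) : dot a (x + y) = dot a x + dot a y := by
  simpa using dot_add_smul a x y 1 1

lemma dot_sub {n : ℕ} (a x y : Fin n → ℝ) : dot a (x - y) = dot a x - dot a y := by
  simpa [sub_eq_add_neg] using dot_add_smul a x y 1 (-1)

lemma dot_smul {n : ℕ} (a x : Fin n → ℝ) (r : ℝ) : dot a (r • x) = r * dot a x := by
  simpa using dot_add_smul a x 0 r 0

lemma dot_comm {n : ℕ} (x y : Fin n → ℝ) : dot x y = dot y x := by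
  simp [dot, mul_comm]

/-- The signed coordinate vectors `±eⱼ`. -/
noncomputable def signedBasis {n : ℕ} (p : Fin n × Bool) : Fin n → ℝ :=
  Pi.single p.1 (if p.2 then 1 else -1)

/-- The average of `s` signed coordinate vectors, scaled by `L`. -/
noncomputable def netPoint {n s : ℕ} (L : ℝ) (T : Sym (Fin n × Bool) s) : Fin n → ℝ :=
  (L / s) • ((T : Multiset (Fin n × Bool)).map signedBasis).sum

lemma exists_inner_signedBasis_le {n : ℕ} (hn : 0 < n) {H : Type*} [NormedAddCommGroup H]
    [InnerProductSpace ℝ H] (A : (Fin n → ℝ) →ₗ[ℝ] H) {q : Fin n → ℝ} {L : ℝ}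
    (hq : l1norm q ≤ L) (y : H) :
    ∃ p, inner ℝ y (A (L • signedBasis p)) ≤ inner ℝ y (A q) := by
  have : Nonempty (Fin n) := ⟨⟨0, hn⟩⟩
  set g : Fin n → ℝ := fun j => inner ℝ y (A (Pi.single j 1)) with hg
  obtain ⟨j, -, hj⟩ := Finset.exists_max_image Finset.univ (fun j => |g j|) Finset.univ_nonempty
  have hexp : inner ℝ y (A q) = ∑ i, q i * g i := by
    conv_lhs => rw [← Finset.univ_sum_single q, map_sum, inner_sum]
    refine Finset.sum_congr rfl fun i _ => ?_
    rw [hg, ← real_inner_smul_right, ← map_smul, ← Pi.single_smul, smul_eq_mul, mul_one]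
  have hlow : -(L * |g j|) ≤ inner ℝ y (A q) := by
    rw [hexp]
    have h1 : |∑ i, q i * g i| ≤ ∑ i, |q i| * |g j| :=
      (Finset.abs_sum_le_sum_abs _ _).trans (Finset.sum_le_sum fun i _ => by
        rw [abs_mul]
        exact mul_le_mul_of_nonneg_left (hj i (Finset.mem_univ _)) (abs_nonneg _))
    rw [← Finset.sum_mul] at h1
    have h2 := mul_le_mul_of_nonneg_right hq (abs_nonneg (g j))
    unfold l1norm at h2
    linarith [neg_abs_le (∑ i, q i * g i)]
  have hval : ∀ b : Bool, inner ℝ y (A (L • signedBasis (j, b))) =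
      L * ((if b then 1 else -1) * g j) := by
    intro b
    have hb : signedBasis (j, b) = (if b then 1 else -1 : ℝ) • (Pi.single j 1 : Fin n → ℝ) := by
      rw [← Pi.single_smul, smul_eq_mul, mul_one, signedBasis]
    rw [hb, map_smul, map_smul, real_inner_smul_right, real_inner_smul_right]
  rcases le_total 0 (g j) with h | h
  · refine ⟨(j, false), ?_⟩
    rw [hval]
    rw [abs_of_nonneg h] at hlow
    simpa using hlow
  · refine ⟨(j, true), ?_⟩
    rw [hval]
    rw [abs_of_nonpos h] at hlow
    simpa using hlow

/-- Maurey's empirical approximation, by greedy selection. -/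
lemma exists_sym_norm_sq_le {n : ℕ} (hn : 0 < n) {H : Type*} [NormedAddCommGroup H]
    [InnerProductSpace ℝ H] (A : (Fin n → ℝ) →ₗ[ℝ] H) {q : Fin n → ℝ} {L R : ℝ} (hL : 0 ≤ L)
    (hq : l1norm q ≤ L) (hR : 0 ≤ R) (hA : ∀ j, ‖A (Pi.single j 1)‖ ≤ R) (s : ℕ) :
    ∃ T : Sym (Fin n × Bool) s,
      ‖A (L • ((T : Multiset (Fin n × Bool)).map signedBasis).sum - (s : ℝ) • q)‖ ^ 2 ≤
        s * (2 * L * R) ^ 2 := by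
  have hAq : ‖A q‖ ≤ L * R := by
    rw [← Finset.univ_sum_single q, map_sum]
    calc ‖∑ i, A (Pi.single i (q i))‖ ≤ ∑ i, |q i| * R := by
          refine (norm_sum_le _ _).trans (Finset.sum_le_sum fun i _ => ?_)
          rw [← mul_one (q i), ← smul_eq_mul, Pi.single_smul, map_smul, norm_smul, smul_eq_mul,
            mul_one, Real.norm_eq_abs]
          exact mul_le_mul_of_nonneg_left (hA i) (abs_nonneg _)
      _ ≤ L * R := by
          rw [← Finset.sum_mul]
          exact mul_le_mul_of_nonneg_right hq hR
  have hAb : ∀ p : Fin n × Bool, ‖A (L • signedBasis p)‖ ≤ L * R := by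
    rintro ⟨j, b⟩
    rw [map_smul, norm_smul, Real.norm_of_nonneg hL]
    refine mul_le_mul_of_nonneg_left ?_ hL
    cases b
    · simpa [signedBasis, Pi.single_neg] using hA j
    · simpa [signedBasis] using hA j
  induction s with
  | zero => exact ⟨Sym.nil, by simp⟩
  | succ s ih =>
    obtain ⟨T, hT⟩ := ih
    set y := A (L • ((T : Multiset (Fin n × Bool)).map signedBasis).sum - (s : ℝ) • q) with hy
    obtain ⟨p, hp⟩ := exists_inner_signedBasis_le hn A hq y
    refine ⟨p ::ₛ T, ?_⟩
    have hsplit : A (L • (((p ::ₛ T : Sym (Fin n × Bool) (s + 1)) :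
        Multiset (Fin n × Bool)).map signedBasis).sum - ((s + 1 : ℕ) : ℝ) • q) =
        y + (A (L • signedBasis p) - A q) := by
      rw [hy, Sym.coe_cons, Multiset.map_cons, Multiset.sum_cons, ← map_sub, ← map_add]
      congr 1
      push_cast
      module
    have hdiff : ‖A (L • signedBasis p) - A q‖ ≤ 2 * L * R := by
      linarith [norm_sub_le (A (L • signedBasis p)) (A q), hAb p]
    have hsq := pow_le_pow_left₀ (norm_nonneg _) hdiff 2
    rw [hsplit, norm_add_sq_real, inner_sub_right]
    push_cast
    linarith

/-- The map `x ↦ (x, (⟨aᵢ, x⟩)ᵢ / √m)` into a Euclidean space. -/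
noncomputable def jointMap {n m : ℕ} (a : Fin m → Fin n → ℝ) :
    (Fin n → ℝ) →ₗ[ℝ] EuclideanSpace ℝ (Fin n ⊕ Fin m) where
  toFun x := WithLp.toLp 2 (Sum.elim x fun i => (Real.sqrt m)⁻¹ * dot (a i) x)
  map_add' x y := by
    ext (i | i) <;> simp [dot_add, mul_add]
  map_smul' r x := by
    ext (i | i)
    · simp
    · simp [dot_smul]; ring

lemma norm_sq_jointMap {n m : ℕ} (a : Fin m → Fin n → ℝ) (x : Fin n → ℝ) :
    ‖jointMap a x‖ ^ 2 = l2norm x ^ 2 + (∑ i, dot (a i) x ^ 2) / m := by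
  rw [EuclideanSpace.norm_sq_eq, Fintype.sum_sum_type, ← dot_self, dot, Finset.sum_div]
  simp only [jointMap, LinearMap.coe_mk, AddHom.coe_mk, Sum.elim_inl, Sum.elim_inr,
    Real.norm_eq_abs, sq_abs]
  congr 1
  · exact Finset.sum_congr rfl fun i _ => sq _
  · refine Finset.sum_congr rfl fun i _ => ?_
    rw [mul_pow, inv_pow, Real.sq_sqrt (Nat.cast_nonneg m)]
    ring

lemma exists_netPoint_close {n m s : ℕ} (hn : 0 < n) (hm : 0 < m) (hs : 0 < s)
    (a : Fin m → Fin n → ℝ) {h : Fin n → ℝ} {L B : ℝ} (hL : 0 ≤ L) (hB : 0 ≤ B)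
    (hh : l1norm h ≤ L) (ha : ∀ j, ∑ i, a i j ^ 2 ≤ B * m) :
    ∃ T : Sym (Fin n × Bool) s,
      l2norm (netPoint L T - h) ^ 2 + (∑ i, dot (a i) (netPoint L T - h) ^ 2) / m ≤
        4 * L ^ 2 * (1 + B) / s := by
  have hm' : (0 : ℝ) < m := Nat.cast_pos.2 hm
  have hs' : (0 : ℝ) < s := Nat.cast_pos.2 hs
  have hA : ∀ j, ‖jointMap a (Pi.single j 1)‖ ≤ Real.sqrt (1 + B) := by
    intro j
    refine Real.le_sqrt_of_sq_le ?_
    rw [norm_sq_jointMap, ← dot_self]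
    have h1 : ∑ i, dot (a i) (Pi.single j 1) ^ 2 = ∑ i, a i j ^ 2 := by
      simp [dot, Pi.single_apply]
    have h2 : dot (Pi.single j 1 : Fin n → ℝ) (Pi.single j 1) = 1 := by
      simp [dot, Pi.single_apply]
    rw [h1, h2]
    gcongr
    exact (div_le_iff₀ hm').2 (ha j)
  obtain ⟨T, hT⟩ := exists_sym_norm_sq_le hn (jointMap a) hL hh (Real.sqrt_nonneg _) hA s
  refine ⟨T, ?_⟩
  have hscale : netPoint L T - h = (s : ℝ)⁻¹ •
      (L • ((T : Multiset (Fin n × Bool)).map signedBasis).sum - (s : ℝ) • h) := by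
    rw [smul_sub, smul_smul, smul_smul, inv_mul_cancel₀ hs'.ne', one_smul, netPoint, inv_mul_eq_div]
  rw [← norm_sq_jointMap, hscale, map_smul, norm_smul, mul_pow, norm_inv, Real.norm_natCast]
  calc ((s : ℝ)⁻¹) ^ 2 * _ ≤ ((s : ℝ)⁻¹) ^ 2 * (s * (2 * L * Real.sqrt (1 + B)) ^ 2) :=
        mul_le_mul_of_nonneg_left hT (sq_nonneg _)
    _ = 4 * L ^ 2 * (1 + B) / s := by
        rw [mul_pow, Real.sq_sqrt (by linarith)]
        field_simp
        ring

lemma alignedPart_le_add {n : ℕ} {u h : Fin n → ℝ} (z : Fin n → ℝ) {a : Fin n → ℝ}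
    (ha : sgn (dot a u) * dot a h ≤ 0) : alignedPart u z a ≤ |dot a (z - h)| := by
  have h1 : |dot a h| = -(sgn (dot a u) * dot a h) := by
    rw [← abs_sgn_mul (dot a u), abs_of_nonpos ha]
  have h2 : |dot a z| ≤ |dot a h| + |dot a (z - h)| := by
    rw [dot_sub]
    have := abs_add_le (dot a h) (dot a z - dot a h)
    rwa [add_sub_cancel] at this
  have h3 : sgn (dot a u) * dot a z - sgn (dot a u) * dot a h ≤ |dot a (z - h)| := by
    rw [← mul_sub, ← dot_sub, ← abs_sgn_mul (dot a u)]
    exact le_abs_self _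
  unfold alignedPart
  linarith

lemma exists_netPoint_of_aligned {n m s : ℕ} (hn : 0 < n) (hm : 0 < m) (hs : 0 < s)
    {a : Fin m → Fin n → ℝ} {u h : Fin n → ℝ} {L B δ ε : ℝ} (hL : 0 ≤ L) (hB : 0 ≤ B)
    (hu : l2norm u = 1) (hh : l2norm h = 1) (hh1 : l1norm h ≤ L)
    (ha : ∀ j, ∑ i, a i j ^ 2 ≤ B * m) (hδ : δ ≤ 1 + dot u h)
    (hal : ∀ i, sgn (dot (a i) u) * dot (a i) h ≤ 0)
    (hε0 : 0 ≤ ε) (hε1 : ε ≤ 1) (hεδ : ε ≤ δ / 4) (hsε : 4 * L ^ 2 * (1 + B) / s ≤ ε ^ 2) :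
    ∃ T : Sym (Fin n × Bool) s, l2norm (netPoint L T) ≤ 2 ∧
      δ / 2 ≤ l2norm (netPoint L T) + dot u (netPoint L T) ∧
      ∑ i, alignedPart u (netPoint L T) (a i) ≤ ε * m := by
  obtain ⟨T, hT⟩ := exists_netPoint_close hn hm hs a hL hB hh1 ha
  refine ⟨T, ?_⟩
  set z := netPoint L T
  replace hT := hT.trans hsε
  have hm' : (0 : ℝ) < m := Nat.cast_pos.2 hm
  have hS : 0 ≤ ∑ i, dot (a i) (z - h) ^ 2 := Finset.sum_nonneg fun _ _ => sq_nonneg _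
  have hd : l2norm (z - h) ≤ ε :=
    (abs_le_of_sq_le_sq' (by have := div_nonneg hS hm'.le; linarith) hε0).2
  have hz := l2norm_add_le h (z - h)
  have hz' := l2norm_add_le z ((-1 : ℝ) • (z - h))
  rw [l2norm_smul] at hz'
  have e1 : h + (z - h) = z := by abel
  have e2 : z + (-1 : ℝ) • (z - h) = h := by module
  rw [e1] at hz
  rw [e2] at hz'
  have hdot := abs_dot_le u (z - h)
  rw [dot_sub, hu, one_mul] at hdot
  have hdot' := (abs_le.1 hdot).1
  simp only [abs_neg, abs_one, one_mul] at hz'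
  refine ⟨by linarith, by linarith, ?_⟩
  have hsum : ∑ i, alignedPart u z (a i) ≤ ∑ i, |dot (a i) (z - h)| :=
    Finset.sum_le_sum fun i _ => alignedPart_le_add z (hal i)
  refine hsum.trans (abs_le_of_sq_le_sq' ?_ (by positivity)).2
  have hcs := sq_sum_le_card_mul_sum_sq (s := Finset.univ) (f := fun i => |dot (a i) (z - h)|)
  simp only [sq_abs, Finset.card_univ, Fintype.card_fin] at hcs
  refine hcs.trans ?_
  have : (∑ i, dot (a i) (z - h) ^ 2) / m ≤ ε ^ 2 := by
    have := sq_nonneg (l2norm (z - h)); linarith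
  rw [div_le_iff₀ hm'] at this
  nlinarith

/-- The sign pattern of `x`, vanishing off the support. -/
noncomputable def signVector {n : ℕ} (x : Fin n → ℝ) : Fin n → ℝ :=
  fun j => if x j = 0 then 0 else sgn (x j)

lemma l2norm_signVector_le {n k : ℕ} {x : Fin n → ℝ} (hk : (Function.support x).ncard ≤ k) :
    l2norm (signVector x) ≤ Real.sqrt k := by
  refine Real.sqrt_le_sqrt ?_
  have h1 : ∀ j, signVector x j ^ 2 = if x j ≠ 0 then 1 else 0 := by
    intro j
    unfold signVector
    by_cases h : x j = 0
    · simp [h]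
    · simp only [h, if_false, ne_eq, not_false_eq_true, if_true]
      rw [← sq_abs, abs_sgn, one_pow]
  have h2 : Function.support x = ↑(Finset.univ.filter fun j => x j ≠ 0) := by
    ext j; simp
  rw [h2, Set.ncard_coe_finset] at hk
  simp_rw [h1]
  rw [Finset.sum_boole]
  exact_mod_cast hk

lemma l1norm_add_dot_signVector_le {n : ℕ} (x h : Fin n → ℝ) :
    l1norm x + dot (signVector x) h ≤ l1norm (x + h) := by
  unfold l1norm dot
  rw [← Finset.sum_add_distrib]
  refine Finset.sum_le_sum fun j _ => ?_
  by_cases hj : x j = 0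
  · simp [signVector, hj]
  · simp only [signVector, hj, if_false, Pi.add_apply]
    rw [← sgn_mul_self (x j), ← mul_add, ← abs_sgn_mul (x j) (x j + h j)]
    exact le_abs_self _

lemma l1norm_add_l1norm_le {n k : ℕ} {x : Fin n → ℝ} (hk : (Function.support x).ncard ≤ k)
    (h : Fin n → ℝ) :
    l1norm x + l1norm h ≤ l1norm (x + h) + 2 * (Real.sqrt k * l2norm h) := by
  have h1 : l1norm x + l1norm h ≤
      l1norm (x + h) + 2 * ∑ j, |signVector x j| * |h j| := by
    unfold l1norm
    rw [← Finset.sum_add_distrib, Finset.mul_sum, ← Finset.sum_add_distrib]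
    refine Finset.sum_le_sum fun j _ => ?_
    by_cases hj : x j = 0
    · simp [signVector, hj]
    · simp only [signVector, hj, if_false, Pi.add_apply, abs_sgn]
      have := abs_sub (x j + h j) (h j)
      rw [add_sub_cancel_right] at this
      linarith
  have h2 := (le_abs_self _).trans
    (abs_dot_le (fun j => |signVector x j|) fun j => |h j|)
  have h3 : ∀ y : Fin n → ℝ, l2norm (fun j => |y j|) = l2norm y := by simp [l2norm]
  rw [h3, h3] at h2
  have h4 := mul_le_mul_of_nonneg_right (l2norm_signVector_le hk) (l2norm_nonneg h)
  unfold dot at h2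
  linarith

lemma l1norm_smul {n : ℕ} (r : ℝ) (x : Fin n → ℝ) : l1norm (r • x) = |r| * l1norm x := by
  simp [l1norm, abs_mul, Finset.mul_sum]

lemma l2norm_pos {n : ℕ} {x : Fin n → ℝ} (hx : x ≠ 0) : 0 < l2norm x := by
  rw [l2norm_eq_norm, norm_pos_iff]
  simpa using hx

lemma l2norm_inv_smul_self {n : ℕ} {x : Fin n → ℝ} (hx : x ≠ 0) :
    l2norm ((l2norm x)⁻¹ • x) = 1 := by
  have h := l2norm_pos hx
  rw [l2norm_smul, abs_of_pos (inv_pos.2 h), inv_mul_cancel₀ h.ne']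

lemma sgn_mul_of_pos {r : ℝ} (hr : 0 < r) (x : ℝ) : sgn (r * x) = sgn x := by
  simp [sgn, mul_nonneg_iff_of_pos_left hr]

/-- If `x0` is not the unique maximizer, some unit vector is nearly sparse, stays away from
`-x0 / ‖x0‖₂`, and points into the feasible polytope at `x0`. -/
lemma exists_aligned_of_not_uniqueMax {n m k : ℕ} {a : Fin m → Fin n → ℝ}
    {x0 φ : Fin n → ℝ} {lam α : ℝ} (hx0 : x0 ≠ 0) (hk : (Function.support x0).ncard ≤ k)
    (hk0 : 0 < k) (hφ : l2norm φ = 1) (hα : dot φ ((l2norm x0)⁻¹ • x0) = α) (hα0 : 0 < α)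
    (hlam : (1 / 2) * α / Real.sqrt k < lam) (hlam' : lam < (3 / 4) * α / Real.sqrt k)
    (hnot : ¬ SPMUniqueMax a x0 φ lam) :
    ∃ h, l2norm h = 1 ∧ l1norm h ≤ 4 * Real.sqrt k / α ∧
      α ^ 2 / 98 ≤ 1 + dot ((l2norm x0)⁻¹ • x0) h ∧
      ∀ i, sgn (dot (a i) ((l2norm x0)⁻¹ • x0)) * dot (a i) h ≤ 0 := by
  have hsk : 0 < Real.sqrt k := Real.sqrt_pos.2 (Nat.cast_pos.2 hk0)
  have hu := l2norm_inv_smul_self hx0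
  have hr := inv_pos.2 (l2norm_pos hx0)
  have hsgn : ∀ i, sgn (dot (a i) ((l2norm x0)⁻¹ • x0)) = sgn (dot (a i) x0) := fun i => by
    rw [dot_smul, sgn_mul_of_pos hr]
  simp only [hsgn]
  set u := (l2norm x0)⁻¹ • x0
  have hα1 : α ≤ 1 := by
    have := (le_abs_self _).trans (abs_dot_le φ u)
    rwa [hα, hφ, hu, one_mul] at this
  rw [div_lt_iff₀ hsk] at hlam
  rw [lt_div_iff₀ hsk] at hlam'
  have hlam0 : 0 < lam := pos_of_mul_pos_left (by linarith) hsk.le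
  unfold SPMUniqueMax at hnot
  push Not at hnot
  obtain ⟨x, hfeas, hne, hobj⟩ := hnot
  have hd := l2norm_pos (sub_ne_zero.2 hne)
  set t := (l2norm (x - x0))⁻¹ with ht
  have ht0 : 0 < t := inv_pos.2 hd
  set h := t • (x - x0) with hh
  have hh1 : l2norm h = 1 := l2norm_inv_smul_self (sub_ne_zero.2 hne)
  have e : x0 + (x - x0) = x := by abel
  have c1 := l1norm_add_dot_signVector_le x0 (x - x0)
  have c2 := l1norm_add_l1norm_le hk (x - x0)
  have c3 := dot_sub φ x x0
  rw [e] at c1 c2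
  have d1 : lam * dot (signVector x0) h ≤ dot φ h := by
    rw [hh, dot_smul, dot_smul, mul_left_comm]
    refine mul_le_mul_of_nonneg_left ?_ ht0.le
    have := mul_le_mul_of_nonneg_left c1 hlam0.le
    linarith
  have d2 : lam * (l1norm h - 2 * Real.sqrt k) ≤ dot φ h := by
    have : lam * (l1norm (x - x0) - 2 * (Real.sqrt k * l2norm (x - x0))) ≤ dot φ (x - x0) := by
      have := mul_le_mul_of_nonneg_left c2 hlam0.le
      linarith
    have := mul_le_mul_of_nonneg_left this ht0.le
    have ht1 : t * l2norm (x - x0) = 1 := inv_mul_cancel₀ hd.ne'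
    rw [hh, dot_smul, l1norm_smul, abs_of_pos ht0]
    linear_combination this + 2 * lam * Real.sqrt k * ht1
  refine ⟨h, hh1, ?_, ?_, fun i => ?_⟩
  · have h1 : dot φ h ≤ 1 := by
      have := (le_abs_self _).trans (abs_dot_le φ h)
      rwa [hφ, hh1, one_mul] at this
    rw [le_div_iff₀ hα0]
    have h2 : lam * (l1norm h - 2 * Real.sqrt k) ≤ 1 := d2.trans h1
    by_cases h3 : l1norm h ≤ 2 * Real.sqrt k
    · nlinarith [mul_le_mul_of_nonneg_left hα1 hsk.le, mul_le_mul_of_nonneg_right h3 hα0.le]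
    · push Not at h3
      have h4 := mul_le_mul_of_nonneg_right hlam.le (sub_nonneg.2 h3.le)
      have h5 := mul_le_mul_of_nonneg_right h2 hsk.le
      nlinarith [mul_le_mul_of_nonneg_left hα1 hsk.le]
  · have h1 := (le_abs_self _).trans (abs_dot_le φ (u + h))
    have h2 := (neg_abs_le _).trans' (neg_le_neg (abs_dot_le (signVector x0) (u + h)))
    have h3 := (le_abs_self _).trans (abs_dot_le (signVector x0) u)
    have hs := l2norm_signVector_le hk
    have h4 := mul_le_mul_of_nonneg_right hs (l2norm_nonneg (u + h))
    rw [dot_add, hα, hφ, one_mul] at h1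
    rw [dot_add] at h2
    rw [hu, mul_one] at h3
    have hN : l2norm (u + h) ^ 2 = 2 + 2 * dot u h := by
      rw [← dot_self, dot_add, dot_comm _ u, dot_comm _ h, dot_add, dot_add, dot_self, dot_self,
        hu, hh1, dot_comm h u]
      ring
    have hN0 := l2norm_nonneg (u + h)
    set N := l2norm (u + h)
    have h5 : α / 7 ≤ N := by
      have h6 : lam * (-(Real.sqrt k * N)) ≤
          lam * (dot (signVector x0) u + dot (signVector x0) h) :=
        mul_le_mul_of_nonneg_left (by linarith) hlam0.le
      have h7 := mul_le_mul_of_nonneg_left (h3.trans hs) hlam0.le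
      have h8 := mul_le_mul_of_nonneg_right hlam'.le hN0
      have h9 := mul_le_mul_of_nonneg_right hα1 hN0
      linarith
    have := pow_le_pow_left₀ (by positivity) h5 2
    linarith
  · have hf := hfeas i
    rw [hh, dot_smul, mul_left_comm, dot_sub]
    refine mul_nonpos_of_nonneg_of_nonpos ht0.le ?_
    unfold sgn
    split_ifs with hp
    · rw [abs_of_nonneg hp] at hf
      linarith
    · rw [abs_of_neg (not_le.1 hp)] at hf
      linarith

lemma card_sym_le (n : ℕ) {s : ℕ} (hs : 0 < s) :
    (Fintype.card (Sym (Fin n × Bool) s) : ℝ) ≤ (Real.exp 1 * ((2 * n + s) / s)) ^ s := by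
  have hs' : (0 : ℝ) < s := Nat.cast_pos.2 hs
  rw [Sym.card_sym_eq_choose, Fintype.card_prod, Fintype.card_fin, Fintype.card_bool]
  have h1 := Nat.choose_le_pow_div (α := ℝ) s (n * 2 + s - 1)
  have h2 : ((n * 2 + s - 1 : ℕ) : ℝ) ≤ 2 * n + s := by
    have : n * 2 + s - 1 ≤ 2 * n + s := by omega
    exact_mod_cast this
  have h3 := Real.pow_div_factorial_le_exp (s : ℝ) hs'.le s
  calc _ ≤ ((n * 2 + s - 1 : ℕ) : ℝ) ^ s / s.factorial := h1
    _ ≤ (2 * n + s) ^ s / s.factorial := by gcongr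
    _ = ((2 * n + s) / s) ^ s * (s ^ s / s.factorial) := by
        rw [div_pow]; field_simp
    _ ≤ ((2 * n + s) / s) ^ s * Real.exp s := by gcongr
    _ = _ := by rw [mul_pow, ← Real.exp_nat_mul, mul_one, mul_comm]

lemma card_sym_mul_le {n k M : ℕ} (hk : 0 < k) (hM : 0 < M) (hnk : (49 : ℝ) * k ≤ n) :
    (Fintype.card (Sym (Fin n × Bool) (M * k)) : ℝ) ≤
      Real.exp (3 * M * (k * Real.log ((n : ℝ) / k))) := by
  have hk' : (0 : ℝ) < k := Nat.cast_pos.2 hk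
  have hM' : (1 : ℝ) ≤ M := Nat.one_le_cast.2 hM
  have hr : 49 ≤ (n : ℝ) / k := (le_div_iff₀ hk').2 hnk
  refine (card_sym_le n (Nat.mul_pos hM hk)).trans ?_
  have h1 : (2 * (n : ℝ) + (M * k : ℕ)) / (M * k : ℕ) ≤ 2 * ((n : ℝ) / k) + 1 := by
    push_cast
    rw [add_div, div_self (by positivity), mul_div_assoc]
    gcongr
    exact le_mul_of_one_le_left hk'.le hM'
  have h2 : Real.exp 1 * (2 * ((n : ℝ) / k) + 1) ≤ ((n : ℝ) / k) ^ 3 := by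
    have he : Real.exp 1 ≤ 3 := by linarith [Real.exp_one_lt_d9]
    set r := (n : ℝ) / k
    have : 49 * 49 * r ≤ r ^ 3 := by nlinarith [mul_self_nonneg (r - 49)]
    have := mul_le_mul_of_nonneg_right he (by linarith : 0 ≤ 2 * r + 1)
    linarith
  calc _ ≤ (((n : ℝ) / k) ^ 3) ^ (M * k) := by
        refine pow_le_pow_left₀ (by positivity) (le_trans ?_ h2) _
        gcongr
    _ = _ := by
        rw [← Real.exp_log (by positivity : (0 : ℝ) < ((n : ℝ) / k) ^ 3), ← Real.exp_nat_mul,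
          Real.log_pow]
        congr 1
        push_cast
        ring

instance isProbabilityMeasure_stdGaussianVectors (m n : ℕ) :
    IsProbabilityMeasure (stdGaussianVectors m n) := by
  unfold stdGaussianVectors; infer_instance

lemma one_le_measure_uniqueMax_add {n m k s : ℕ} {x0 φ : Fin n → ℝ} {lam α γ B δ ε : ℝ}
    (hn : 0 < n) (hm : 0 < m) (hs : 0 < s) (hk0 : 0 < k) (hx0 : x0 ≠ 0)
    (hk : (Function.support x0).ncard ≤ k) (hφ : l2norm φ = 1)
    (hα : dot φ ((l2norm x0)⁻¹ • x0) = α) (hγ : 0 < γ) (hγα : γ < α)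
    (hlam : (1 / 2) * α / Real.sqrt k < lam) (hlam' : lam < (3 / 4) * α / Real.sqrt k)
    (hB0 : 0 < B) (hB : ∀ j : Fin n, stdGaussianVectors m n {a | B * m ≤ ∑ i, a i j ^ 2} ≤
      ENNReal.ofReal (Real.exp (-m)))
    (hδ0 : 0 < δ) (hδ : δ ≤ γ ^ 2 / 98) (hε0 : 0 ≤ ε) (hε1 : ε ≤ 1) (hεδ : ε ≤ δ / 4)
    (hεκ : ε ≤ gaussianAbsMoment * (δ / 2) / 8)
    (hsε : 4 * (4 * Real.sqrt k / γ) ^ 2 * (1 + B) / s ≤ ε ^ 2) :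
    1 ≤ stdGaussianVectors m n {a | SPMUniqueMax a x0 φ lam} +
      ENNReal.ofReal (n * Real.exp (-m) + Fintype.card (Sym (Fin n × Bool) s) *
        Real.exp (-((gaussianAbsMoment * (δ / 2)) ^ 2 / 64) * m)) := by
  set u := (l2norm x0)⁻¹ • x0 with hu_def
  have hu : l2norm u = 1 := l2norm_inv_smul_self hx0
  set z : Sym (Fin n × Bool) s → Fin n → ℝ := netPoint (4 * Real.sqrt k / γ) with hz
  set Z : Sym (Fin n × Bool) s → Set (Fin m → Fin n → ℝ) := fun T =>
    {a | (l2norm (z T) ≤ 2 ∧ δ / 2 ≤ l2norm (z T) + dot u (z T)) ∧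
      ∑ i, alignedPart u (z T) (a i) ≤ ε * m} with hZ
  have hcover : (Set.univ : Set (Fin m → Fin n → ℝ)) ⊆
      {a | SPMUniqueMax a x0 φ lam} ∪
        ((⋃ j : Fin n, {a | B * m ≤ ∑ i, a i j ^ 2}) ∪ ⋃ T, Z T) := by
    intro a _
    by_cases hmax : SPMUniqueMax a x0 φ lam
    · exact Or.inl hmax
    by_cases hcol : ∃ j, B * m ≤ ∑ i, a i j ^ 2
    · exact Or.inr (Or.inl (Set.mem_iUnion.2 hcol))
    push Not at hcol
    obtain ⟨h, hh, hh1, hhu, hal⟩ := exists_aligned_of_not_uniqueMax hx0 hk hk0 hφ hα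
      (hγ.trans hγα) hlam hlam' hmax
    have hL : l1norm h ≤ 4 * Real.sqrt k / γ := hh1.trans (by gcongr)
    have hδα : δ ≤ 1 + dot u h := by
      have := pow_le_pow_left₀ hγ.le hγα.le 2
      linarith
    obtain ⟨T, hT1, hT2, hT3⟩ := exists_netPoint_of_aligned (s := s) hn hm hs (by positivity)
      hB0.le hu hh hL (fun j => (hcol j).le) hδα hal hε0 hε1 hεδ hsε
    exact Or.inr (Or.inr (Set.mem_iUnion.2 ⟨T, ⟨hT1, hT2⟩, hT3⟩))
  have hZT : ∀ T, stdGaussianVectors m n (Z T) ≤ ENNReal.ofReal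
      (Real.exp (-((gaussianAbsMoment * (δ / 2)) ^ 2 / 64) * m)) := by
    intro T
    by_cases hT : l2norm (z T) ≤ 2 ∧ δ / 2 ≤ l2norm (z T) + dot u (z T)
    · refine (measure_mono fun a ha => ha.2).trans
        (measure_sum_alignedPart_le m hu hT.1 (half_pos hδ0) hT.2 hεκ)
    · simp [hZ, hT]
  calc (1 : ENNReal) = stdGaussianVectors m n Set.univ := measure_univ.symm
    _ ≤ stdGaussianVectors m n {a | SPMUniqueMax a x0 φ lam} +
          (∑ j : Fin n, stdGaussianVectors m n {a | B * m ≤ ∑ i, a i j ^ 2} +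
            ∑ T, stdGaussianVectors m n (Z T)) :=
        (measure_mono hcover).trans <| (measure_union_le _ _).trans <| by
          gcongr
          exact (measure_union_le _ _).trans
            (add_le_add (measure_iUnion_fintype_le _ _) (measure_iUnion_fintype_le _ _))
    _ ≤ _ := by
        gcongr
        refine (add_le_add (Finset.sum_le_sum fun j _ => hB j)
          (Finset.sum_le_sum fun T _ => hZT T)).trans_eq ?_
        rw [Finset.sum_const, Finset.sum_const, Finset.card_univ, Finset.card_univ,
          Fintype.card_fin, ENNReal.ofReal_add (by positivity) (by positivity),
          ENNReal.ofReal_mul (by positivity), ENNReal.ofReal_mul (by positivity),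
          ENNReal.ofReal_natCast, ENNReal.ofReal_natCast, nsmul_eq_mul, nsmul_eq_mul]

lemma natCast_mul_exp_neg_le {n m k : ℕ} (hk : 0 < k) (hnk : (49 : ℝ) * k ≤ n)
    (hm : 2 * (k * Real.log ((n : ℝ) / k)) ≤ m) (hlog : 1 ≤ Real.log ((n : ℝ) / k)) :
    n * Real.exp (-m) ≤ Real.exp (-k) := by
  have hk' : (0 : ℝ) < k := Nat.cast_pos.2 hk
  have hk1 : (1 : ℝ) ≤ k := Nat.one_le_cast.2 hk
  have hn : (0 : ℝ) < n := by linarith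
  have h1 := Real.log_le_sub_one_of_pos hk'
  have h2 : Real.log n = Real.log k + Real.log ((n : ℝ) / k) := by
    rw [Real.log_div hn.ne' hk'.ne']; ring
  rw [← Real.exp_log hn, ← Real.exp_add, Real.exp_le_exp, h2]
  nlinarith

/-- **Corollary 2 (SparsePhaseMax with constant correlation).** Fix `0 < γ ≤ 1`. If `x0` is
`k`-sparse, the `a i` are i.i.d. standard Gaussian vectors, `φ` is a unit anchor vector whose
correlation `α` with `x0 / ‖x0‖₂` exceeds `γ`, `k < (1/49)·α²·n`, and
`(1/2)·α/√k < λ < (3/4)·α/√k`, then there exist positive constants `C₂, c` (universal) and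
`C₁` (depending only on `γ`) such that `m ≥ C₁·k·log(n/k)` implies that `x0` is the unique
maximizer of SparsePhaseMax with probability at least `1 − C₂·exp(−c·k)`. -/
theorem sparsePhaseMax_corollary :
    ∃ C₂ c : ℝ, 0 < C₂ ∧ 0 < c ∧
      ∀ γ : ℝ, 0 < γ → γ ≤ 1 →
        ∃ C₁ : ℝ, 0 < C₁ ∧
          ∀ (n m k : ℕ) (x0 φ : Fin n → ℝ) (lam α : ℝ),
            (Function.support x0).ncard ≤ k →
            l2norm φ = 1 →
            dot φ ((l2norm x0)⁻¹ • x0) = α →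
            γ < α →
            (k : ℝ) < (1 / 49) * α ^ 2 * n →
            (1 / 2) * α / Real.sqrt k < lam →
            lam < (3 / 4) * α / Real.sqrt k →
            (m : ℝ) ≥ C₁ * k * Real.log ((n : ℝ) / k) →
            stdGaussianVectors m n {a : Fin m → Fin n → ℝ | SPMUniqueMax a x0 φ lam} ≥
              ENNReal.ofReal (1 - C₂ * Real.exp (-c * k)) := by
  obtain ⟨B, hB0, hB⟩ := exists_measure_sum_sq_le
  refine ⟨2, 1, two_pos, one_pos, fun γ hγ hγ1 => ?_⟩
  have hκ := gaussianAbsMoment_pos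
  set δ := γ ^ 2 / 98 with hδ
  have hδ0 : 0 < δ := by positivity
  have hδ1 : δ ≤ 1 := by
    have := pow_le_one₀ hγ.le hγ1 (n := 2)
    rw [hδ]; linarith
  set ε := min (δ / 4) (gaussianAbsMoment * (δ / 2) / 8) with hε
  have hε0 : 0 < ε := lt_min (by positivity) (by positivity)
  have hεδ : ε ≤ δ / 4 := min_le_left _ _
  obtain ⟨M, hM⟩ := exists_nat_ge (64 * (1 + B) / (γ ^ 2 * ε ^ 2))
  have hM0 : 0 < M := by
    have : (0 : ℝ) < M := lt_of_lt_of_le (by positivity) hM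
    exact_mod_cast this
  set c₁ := (gaussianAbsMoment * (δ / 2)) ^ 2 / 64 with hc₁
  have hc₁0 : 0 < c₁ := by positivity
  refine ⟨max 2 ((3 * M + 1) / c₁), lt_max_of_lt_left two_pos, ?_⟩
  intro n m k x0 φ lam α hk hφ hα hγα hkn hlam hlam' hm
  have hα0 := hγ.trans hγα
  have hx0 : x0 ≠ 0 := by
    rintro rfl
    simp [dot] at hα
    exact hα0.ne hα
  have hk0 : 0 < k := by
    refine lt_of_lt_of_le ?_ hk
    rw [Set.ncard_pos (Set.toFinite _)]
    exact Function.support_nonempty_iff.2 hx0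
  have hk' : (0 : ℝ) < k := Nat.cast_pos.2 hk0
  have hα1 : α ≤ 1 := by
    have := (le_abs_self _).trans (abs_dot_le φ ((l2norm x0)⁻¹ • x0))
    rwa [hα, hφ, l2norm_inv_smul_self hx0, one_mul] at this
  have hnk : (49 : ℝ) * k ≤ n := by
    have h1 := pow_le_one₀ hα0.le hα1 (n := 2)
    have h2 := mul_le_mul_of_nonneg_right h1 (Nat.cast_nonneg (α := ℝ) n)
    linarith
  have hn : 0 < n := by
    have : (0 : ℝ) < n := by linarith
    exact_mod_cast this
  have hlog : 1 ≤ Real.log ((n : ℝ) / k) := by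
    have hr : 49 ≤ (n : ℝ) / k := (le_div_iff₀ hk').2 hnk
    rw [Real.le_log_iff_exp_le (by linarith)]
    linarith [Real.exp_one_lt_d9]
  rw [ge_iff_le, mul_assoc] at hm
  have hkl : (k : ℝ) ≤ k * Real.log ((n : ℝ) / k) := le_mul_of_one_le_right hk'.le hlog
  have hm2 : 2 * (k * Real.log ((n : ℝ) / k)) ≤ m :=
    (mul_le_mul_of_nonneg_right (le_max_left _ _) (by linarith)).trans hm
  have hm3 : (3 * M + 1) * (k * Real.log ((n : ℝ) / k)) ≤ c₁ * m := by
    have := (mul_le_mul_of_nonneg_right (le_max_right _ _) (by linarith)).trans hm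
    rwa [div_mul_eq_mul_div, div_le_iff₀' hc₁0] at this
  have hm0 : 0 < m := by
    have : (0 : ℝ) < m := by linarith
    exact_mod_cast this
  have hsε : 4 * (4 * Real.sqrt k / γ) ^ 2 * (1 + B) / (M * k : ℕ) ≤ ε ^ 2 := by
    have hM' : (0 : ℝ) < M := Nat.cast_pos.2 hM0
    rw [div_le_iff₀ (by positivity)] at hM
    rw [div_pow, mul_pow, Real.sq_sqrt hk'.le]
    push_cast
    rw [div_le_iff₀ (by positivity), mul_div_assoc', div_mul_eq_mul_div,
      div_le_iff₀ (by positivity)]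
    linear_combination (k : ℝ) * hM
  have hmain := one_le_measure_uniqueMax_add hn hm0 (Nat.mul_pos hM0 hk0) hk0 hx0 hk hφ hα hγ hγα
    hlam hlam' hB0 (hB n m) hδ0 le_rfl hε0.le (by linarith) hεδ (min_le_right _ _) hsε
  have hfail : n * Real.exp (-m) + Fintype.card (Sym (Fin n × Bool) (M * k)) *
      Real.exp (-c₁ * m) ≤ 2 * Real.exp (-1 * k) := by
    have h1 := natCast_mul_exp_neg_le hk0 hnk hm2 hlog
    have h2 : Fintype.card (Sym (Fin n × Bool) (M * k)) * Real.exp (-c₁ * m) ≤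
        Real.exp (-k) := by
      refine (mul_le_mul_of_nonneg_right (card_sym_mul_le hk0 hM0 hnk)
        (Real.exp_nonneg _)).trans ?_
      rw [← Real.exp_add, Real.exp_le_exp]
      linarith
    rw [neg_one_mul]
    linarith
  rw [ge_iff_le, ENNReal.ofReal_sub _ (by positivity), ENNReal.ofReal_one, tsub_le_iff_right]
  exact hmain.trans (by gcongr)
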